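/- arXiv:2303.00315 — 2 statements merged into one kernel-verified Lean document; each statement's English description precedes it below -/
import Mathlib

section
/- Let θ* ∈ ℝ^d, x_1,…,x_m ∈ ℝ^d, ε_1,…,ε_m ∈ ℝ, β > 0, M = Σ_{i=1}^m x_i x_iᵀ + β I, and θ̂ = M⁻¹ (Σ_{i=1}^m x_i (x_iᵀθ* + ε_i)). Then for every x ∈ ℝ^d, |xᵀ(θ̂ − θ*)| ≤ ‖x‖_{M⁻¹} · ( √β ‖θ*‖₂ + ‖Σ_{i=1}^m x_i ε_i‖_{M⁻¹} ). -/
open Matrix Finset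

/-- Cauchy–Schwarz inequality for the bilinear form of a positive semidefinite matrix. -/
theorem Matrix.PosSemidef.abs_dotProduct_mulVec_le {n : Type*} [Fintype n]
    {N : Matrix n n ℝ} (hN : N.PosSemidef) (u v : n → ℝ) :
    |u ⬝ᵥ (N *ᵥ v)| ≤ Real.sqrt (u ⬝ᵥ (N *ᵥ u)) * Real.sqrt (v ⬝ᵥ (N *ᵥ v)) := by
  have hnonneg (w : n → ℝ) : 0 ≤ w ⬝ᵥ (N *ᵥ w) := by
    simpa using hN.dotProduct_mulVec_nonneg w
  have hsymm : v ⬝ᵥ (N *ᵥ u) = u ⬝ᵥ (N *ᵥ v) := by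
    have hT : Nᵀ = N := by simpa using hN.isHermitian.eq
    rw [dotProduct_mulVec, ← mulVec_transpose, hT, dotProduct_comm]
  have hquad (t : ℝ) :
      0 ≤ (v ⬝ᵥ (N *ᵥ v)) * (t * t) + (2 * (u ⬝ᵥ (N *ᵥ v))) * t + u ⬝ᵥ (N *ᵥ u) := by
    have h := hnonneg (u + t • v)
    simp only [mulVec_add, mulVec_smul, add_dotProduct, dotProduct_add, smul_dotProduct,
      dotProduct_smul, smul_eq_mul, hsymm] at h
    linarith
  have hdiscrim := discrim_le_zero hquad
  rw [discrim] at hdiscrim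
  rw [← Real.sqrt_mul (hnonneg u)]
  exact Real.abs_le_sqrt (by linarith)

/-- If `S` is positive semidefinite and `β > 0`, then `β ‖v‖²` in the norm of `(S + β I)⁻¹`
is at most the squared Euclidean norm of `v`. -/
theorem Matrix.PosSemidef.mul_dotProduct_inv_add_smul_one_mulVec_le {n : Type*} [Fintype n]
    [DecidableEq n] {S : Matrix n n ℝ} (hS : S.PosSemidef) {β : ℝ} (hβ : 0 < β) (v : n → ℝ) :
    β * (v ⬝ᵥ ((S + β • (1 : Matrix n n ℝ))⁻¹ *ᵥ v)) ≤ v ⬝ᵥ v := by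
  have hM : (S + β • (1 : Matrix n n ℝ)).PosDef := PosDef.posSemidef_add hS (PosDef.one.smul hβ)
  set u := (S + β • (1 : Matrix n n ℝ))⁻¹ *ᵥ v with hu
  have hv : v = S *ᵥ u + β • u := by
    have h : (S + β • (1 : Matrix n n ℝ)) *ᵥ u = v := by
      rw [hu, mulVec_mulVec, mul_nonsing_inv _ ((isUnit_iff_isUnit_det _).mp hM.isUnit),
        one_mulVec]
    rw [← h, add_mulVec, smul_mulVec, one_mulVec]
  have hSu : 0 ≤ u ⬝ᵥ (S *ᵥ u) := by simpa using hS.dotProduct_mulVec_nonneg u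
  have hSS : 0 ≤ (S *ᵥ u) ⬝ᵥ (S *ᵥ u) := by simpa using dotProduct_star_self_nonneg (S *ᵥ u)
  clear_value u
  subst hv
  simp only [add_dotProduct, dotProduct_add, smul_dotProduct, dotProduct_smul, smul_eq_mul,
    dotProduct_comm (S *ᵥ u) u]
  nlinarith [mul_nonneg hβ.le hSu]

/-- Confidence bound for the regularized least-squares estimate: with
`M = ∑ i, x_i x_iᵀ + β I` and `θ̂ = M⁻¹ (∑ i, (x_iᵀθ* + ε_i) • x_i)`, for every
`x ∈ ℝ^d`,
`|xᵀ(θ̂ − θ*)| ≤ ‖x‖_{M⁻¹} (√β ‖θ*‖₂ + ‖∑ i, ε_i x_i‖_{M⁻¹})`,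
where `‖y‖_N := √(yᵀ N y)`. -/
theorem stmt_6 {d m : ℕ} (θstar : Fin d → ℝ)
    (x : Fin m → (Fin d → ℝ)) (ε : Fin m → ℝ)
    (β : ℝ) (hβ : 0 < β)
    (M : Matrix (Fin d) (Fin d) ℝ)
    (hM : M = ∑ i, vecMulVec (x i) (x i) + β • (1 : Matrix (Fin d) (Fin d) ℝ))
    (θhat : Fin d → ℝ)
    (hθhat : θhat = M⁻¹ *ᵥ (∑ i, (x i ⬝ᵥ θstar + ε i) • x i))
    (y : Fin d → ℝ) :
    |y ⬝ᵥ (θhat - θstar)|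
      ≤ Real.sqrt (y ⬝ᵥ (M⁻¹ *ᵥ y)) *
        (Real.sqrt β * Real.sqrt (θstar ⬝ᵥ θstar)
          + Real.sqrt ((∑ i, ε i • x i) ⬝ᵥ (M⁻¹ *ᵥ (∑ i, ε i • x i)))) := by
  set S := ∑ i, vecMulVec (x i) (x i) with hSdef
  set w := ∑ i, ε i • x i with hw
  have hS : S.PosSemidef :=
    posSemidef_sum _ fun i _ => by simpa using posSemidef_vecMulVec_self_star (x i)
  have hMpos : M.PosDef := hM ▸ PosDef.posSemidef_add hS (PosDef.one.smul hβ)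
  have hNpos : (M⁻¹).PosSemidef := hMpos.inv.posSemidef
  have hsum : ∑ i, (x i ⬝ᵥ θstar + ε i) • x i = M *ᵥ θstar - β • θstar + w := by
    have hSθ : S *ᵥ θstar = ∑ i, (x i ⬝ᵥ θstar) • x i := by
      simp [hSdef, sum_mulVec, vecMulVec_mulVec]
    rw [hM, add_mulVec, smul_mulVec, one_mulVec, add_sub_cancel_right, hSθ, hw,
      ← sum_add_distrib]
    simp only [add_smul]
  have herr : θhat - θstar = M⁻¹ *ᵥ w - β • (M⁻¹ *ᵥ θstar) := by
    rw [hθhat, hsum, mulVec_add, mulVec_sub, mulVec_mulVec, mulVec_smul,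
      nonsing_inv_mul _ ((isUnit_iff_isUnit_det _).mp hMpos.isUnit), one_mulVec]
    abel
  have hbias : β * Real.sqrt (θstar ⬝ᵥ (M⁻¹ *ᵥ θstar))
      ≤ Real.sqrt β * Real.sqrt (θstar ⬝ᵥ θstar) := by
    have h := hS.mul_dotProduct_inv_add_smul_one_mulVec_le hβ θstar
    rw [← hM] at h
    calc β * Real.sqrt (θstar ⬝ᵥ (M⁻¹ *ᵥ θstar))
        = Real.sqrt β * Real.sqrt (β * (θstar ⬝ᵥ (M⁻¹ *ᵥ θstar))) := by
          rw [Real.sqrt_mul hβ.le, ← mul_assoc, Real.mul_self_sqrt hβ.le]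
      _ ≤ _ := by gcongr
  have hyw := hNpos.abs_dotProduct_mulVec_le y w
  have hyθ := hNpos.abs_dotProduct_mulVec_le y θstar
  rw [herr, dotProduct_sub, dotProduct_smul, smul_eq_mul]
  calc |y ⬝ᵥ (M⁻¹ *ᵥ w) - β * (y ⬝ᵥ (M⁻¹ *ᵥ θstar))|
      ≤ |y ⬝ᵥ (M⁻¹ *ᵥ w)| + β * |y ⬝ᵥ (M⁻¹ *ᵥ θstar)| := by
        simpa [abs_mul, abs_of_pos hβ] using
          abs_sub (y ⬝ᵥ (M⁻¹ *ᵥ w)) (β * (y ⬝ᵥ (M⁻¹ *ᵥ θstar)))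
    _ ≤ Real.sqrt (y ⬝ᵥ (M⁻¹ *ᵥ y)) * Real.sqrt (w ⬝ᵥ (M⁻¹ *ᵥ w))
        + β * (Real.sqrt (y ⬝ᵥ (M⁻¹ *ᵥ y)) * Real.sqrt (θstar ⬝ᵥ (M⁻¹ *ᵥ θstar))) := by
        gcongr
    _ = Real.sqrt (y ⬝ᵥ (M⁻¹ *ᵥ y)) * (β * Real.sqrt (θstar ⬝ᵥ (M⁻¹ *ᵥ θstar))
        + Real.sqrt (w ⬝ᵥ (M⁻¹ *ᵥ w))) := by ring
    _ ≤ _ := by gcongr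
end

section
/- Let x_1,…,x_T ∈ ℝ^d with ‖x_t‖₂ ≤ 1 for all t, let β ≥ 1, and define V_t = β I + Σ_{s=1}^{t−1} x_s x_sᵀ for t = 1,…,T. Then Σ_{t=1}^T x_tᵀ V_t⁻¹ x_t ≤ 2 log( det(V_{T+1}) / det(β I) ) ≤ 2 d log(1 + T/(β d)). -/
open Matrix Finset Real

/-- The rank-one case of the matrix determinant lemma. -/
lemma det_add_vecMulVec_eq {n : Type*} [Fintype n] [DecidableEq n] {A : Matrix n n ℝ}
    (hA : IsUnit A.det) (u v : n → ℝ) :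
    (A + vecMulVec u v).det = A.det * (1 + v ⬝ᵥ (A⁻¹ *ᵥ u)) := by
  rw [vecMulVec_eq Unit, det_add_replicateCol_mul_replicateRow hA, det_unique (n := Unit)]
  congr 1
  rw [Matrix.mul_assoc, ← replicateCol_mulVec, replicateRow_mul_replicateCol]
  simp

/-- The tangent-line form of the determinant-trace inequality. -/
lemma Matrix.PosDef.log_det_le {n : Type*} [Fintype n] [DecidableEq n] {A : Matrix n n ℝ}
    (hA : A.PosDef) {c : ℝ} (hc : 0 < c) :
    Real.log A.det ≤ Fintype.card n * Real.log c + (A.trace / c - Fintype.card n) := by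
  have hdet := hA.isHermitian.det_eq_prod_eigenvalues
  have htr := hA.isHermitian.trace_eq_sum_eigenvalues
  simp only [RCLike.ofReal_real_eq_id, id] at hdet htr
  rw [hdet, htr, Real.log_prod fun i _ => (hA.eigenvalues_pos i).ne']
  calc ∑ i, Real.log (hA.isHermitian.eigenvalues i)
      ≤ ∑ i, (Real.log c + (hA.isHermitian.eigenvalues i / c - 1)) := by
        refine Finset.sum_le_sum fun i _ => ?_
        have hi := hA.eigenvalues_pos i
        have h := Real.log_le_sub_one_of_pos (div_pos hi hc)
        rw [Real.log_div hi.ne' hc.ne'] at h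
        linarith
    _ = _ := by
        simp [Finset.sum_add_distrib, Finset.sum_div]

lemma Matrix.posSemidef_sum_vecMulVec_self {n ι : Type*} [Fintype n] (s : Finset ι)
    (x : ι → n → ℝ) : (∑ i ∈ s, vecMulVec (x i) (x i)).PosSemidef :=
  posSemidef_sum s fun i _ => by simpa using posSemidef_vecMulVec_self_star (x i)

/-- If `B - I` is positive semidefinite and `‖x‖ ≤ 1`, then `xᵀ B⁻¹ x ≤ 1`. -/
lemma dotProduct_inv_mulVec_le_one {n : Type*} [Fintype n] [DecidableEq n] {B : Matrix n n ℝ}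
    (hB : B.PosDef) (hB1 : (B - 1).PosSemidef) {x : n → ℝ} (hx : x ⬝ᵥ x ≤ 1) :
    x ⬝ᵥ (B⁻¹ *ᵥ x) ≤ 1 := by
  set y := B⁻¹ *ᵥ x with hy
  have hBy : B *ᵥ y = x := by
    rw [hy, mulVec_mulVec, mul_nonsing_inv _ hB.det_pos.ne'.isUnit, one_mulVec]
  have h : y ⬝ᵥ y ≤ x ⬝ᵥ y := by
    have := hB1.dotProduct_mulVec_nonneg y
    rw [sub_mulVec, one_mulVec, hBy, star_trivial, dotProduct_sub, dotProduct_comm y x] at this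
    linarith
  have hsq : 0 ≤ (x - y) ⬝ᵥ (x - y) := Finset.sum_nonneg fun i _ => mul_self_nonneg _
  simp only [dotProduct_sub, sub_dotProduct, dotProduct_comm y x] at hsq
  linarith

lemma le_two_mul_log_one_add {w : ℝ} (h0 : 0 ≤ w) (h2 : w ≤ 2) : w ≤ 2 * Real.log (1 + w) := by
  have h := Real.le_log_one_add_of_nonneg h0
  have h' : w / 2 ≤ 2 * w / (w + 2) := by
    rw [div_le_div_iff₀ (by norm_num) (by linarith)]
    nlinarith
  linarith

/-- Elliptic potential lemma: for vectors `x_1, …, x_T ∈ ℝ^d` of Euclidean norm at most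
`1`, `β ≥ 1` and `V_t = β I + ∑_{s < t} x_s x_sᵀ`,
`∑_{t=1}^T x_tᵀ V_t⁻¹ x_t ≤ 2 log (det V_{T+1} / det (β I)) ≤ 2 d log (1 + T/(β d))`.
(Here the round `t` in the informal statement corresponds to the index `t - 1` below,
so `V` at informal time `t` is `V (t-1)` and `V_{T+1}` is `V T`.) -/
theorem stmt_17 {d : ℕ} (T : ℕ) (x : ℕ → (Fin d → ℝ))
    (hx : ∀ t, Real.sqrt (x t ⬝ᵥ x t) ≤ 1)
    (β : ℝ) (hβ : 1 ≤ β)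
    (V : ℕ → Matrix (Fin d) (Fin d) ℝ)
    (hV : ∀ t, V t = β • (1 : Matrix (Fin d) (Fin d) ℝ)
      + ∑ s ∈ Finset.range t, vecMulVec (x s) (x s)) :
    (∑ t ∈ Finset.range T, x t ⬝ᵥ ((V t)⁻¹ *ᵥ x t))
        ≤ 2 * Real.log ((V T).det / (β • (1 : Matrix (Fin d) (Fin d) ℝ)).det)
      ∧ 2 * Real.log ((V T).det / (β • (1 : Matrix (Fin d) (Fin d) ℝ)).det)
        ≤ 2 * d * Real.log (1 + T / (β * d)) := by
  have hβ0 : 0 < β := by linarith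
  have hx1 : ∀ t, x t ⬝ᵥ x t ≤ 1 := fun t => by simpa using hx t
  have hβI : (β • (1 : Matrix (Fin d) (Fin d) ℝ)).PosDef := PosDef.one.smul hβ0
  have hpos : ∀ t, (V t).PosDef := fun t => by
    rw [hV]
    exact hβI.add_posSemidef (posSemidef_sum_vecMulVec_self _ _)
  have hsub : ∀ t, (V t - 1).PosSemidef := fun t => by
    have h : V t - 1 = (β - 1) • (1 : Matrix (Fin d) (Fin d) ℝ)
        + ∑ s ∈ Finset.range t, vecMulVec (x s) (x s) := by
      rw [hV, sub_smul, one_smul]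
      abel
    rw [h]
    exact (PosSemidef.one.smul (sub_nonneg.2 hβ)).add (posSemidef_sum_vecMulVec_self _ _)
  rw [Real.log_div (hpos T).det_pos.ne' hβI.det_pos.ne']
  constructor
  · have hV0 : V 0 = β • (1 : Matrix (Fin d) (Fin d) ℝ) := by simp [hV]
    rw [← hV0, ← Finset.sum_range_sub (fun t => Real.log (V t).det), Finset.mul_sum]
    refine Finset.sum_le_sum fun t _ => ?_
    have hw0 : 0 ≤ x t ⬝ᵥ ((V t)⁻¹ *ᵥ x t) := by
      simpa using (hpos t).inv.posSemidef.dotProduct_mulVec_nonneg (x t)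
    have hw1 := dotProduct_inv_mulVec_le_one (hpos t) (hsub t) (hx1 t)
    have hsucc : V (t + 1) = V t + vecMulVec (x t) (x t) := by
      rw [hV, hV, Finset.sum_range_succ, add_assoc]
    rw [hsucc, det_add_vecMulVec_eq (hpos t).det_pos.ne'.isUnit,
      Real.log_mul (hpos t).det_pos.ne' (by linarith), add_sub_cancel_left]
    exact le_two_mul_log_one_add hw0 (by linarith)
  · rcases Nat.eq_zero_or_pos d with rfl | hd
    · simp
    have hd' : (0 : ℝ) < d := Nat.cast_pos.2 hd
    have hm : 0 < 1 + T / (β * d) := by positivity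
    have htr : (V T).trace ≤ β * d + T := by
      rw [hV, trace_add, trace_smul, trace_one, trace_sum, Fintype.card_fin, smul_eq_mul]
      gcongr
      calc ∑ s ∈ Finset.range T, (vecMulVec (x s) (x s)).trace
          ≤ ∑ _s ∈ Finset.range T, (1 : ℝ) :=
            Finset.sum_le_sum fun s _ => by simpa only [trace_vecMulVec] using hx1 s
        _ = T := by simp
    have hdiv : (V T).trace / (β * (1 + T / (β * d))) ≤ d := by
      rw [div_le_iff₀ (by positivity)]
      refine htr.trans_eq ?_
      field_simp
    have h := (hpos T).log_det_le (mul_pos hβ0 hm)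
    rw [Real.log_mul hβ0.ne' hm.ne', Fintype.card_fin] at h
    rw [det_smul, det_one, mul_one, Fintype.card_fin, Real.log_pow]
    linarith
end
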